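/- arXiv:1507.05056 — 4 statements merged into one kernel-verified Lean document; each statement's English description precedes it below -/
import Mathlib

section
/- Let A be a symmetric positive definite real n×n matrix. Then for every skew-symmetric real n×n matrix Λ, the determinant det(A − Λ) is strictly positive. -/
open Matrix

theorem Matrix.det_ne_zero_of_dotProduct_mulVec_pos {ι : Type*} [Fintype ι] [DecidableEq ι]
    {M : Matrix ι ι ℝ} (hM : ∀ x : ι → ℝ, x ≠ 0 → 0 < x ⬝ᵥ (M *ᵥ x)) : M.det ≠ 0 := by
  intro h
  obtain ⟨v, hv, hMv⟩ := Matrix.exists_mulVec_eq_zero_iff.mpr h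
  simpa [hMv] using hM v hv

/-- A real matrix, not necessarily symmetric, whose quadratic form is positive definite has
positive determinant: its determinant cannot vanish along the segment joining it to `1`. -/
theorem Matrix.det_pos_of_dotProduct_mulVec_pos {ι : Type*} [Fintype ι] [DecidableEq ι]
    {M : Matrix ι ι ℝ} (hM : ∀ x : ι → ℝ, x ≠ 0 → 0 < x ⬝ᵥ (M *ᵥ x)) : 0 < M.det := by
  by_contra! hle
  let f : ℝ → ℝ := fun t => ((1 - t) • (1 : Matrix ι ι ℝ) + t • M).det
  have hf : Continuous f := by
    unfold f
    fun_prop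
  have hmem : (0 : ℝ) ∈ Set.Icc (f 1) (f 0) := by
    constructor <;> simp [f, hle]
  obtain ⟨t, ⟨ht0, ht1⟩, ht⟩ :=
    intermediate_value_Icc' (zero_le_one' ℝ) hf.continuousOn hmem
  refine Matrix.det_ne_zero_of_dotProduct_mulVec_pos (fun x hx => ?_) ht
  have hxx : 0 < x ⬝ᵥ x := by
    simpa using Matrix.dotProduct_star_self_pos_iff.mpr hx
  have hMx := hM x hx
  simp only [Matrix.add_mulVec, Matrix.smul_mulVec, Matrix.one_mulVec, dotProduct_add,
    dotProduct_smul, smul_eq_mul]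
  rcases ht0.eq_or_lt with rfl | ht0
  · simpa using hxx
  · have h₁ : 0 ≤ (1 - t) * (x ⬝ᵥ x) := mul_nonneg (sub_nonneg.mpr ht1) hxx.le
    have h₂ : 0 < t * (x ⬝ᵥ (M *ᵥ x)) := mul_pos ht0 hMx
    linarith

theorem Matrix.dotProduct_mulVec_self_eq_zero_of_transpose_eq_neg {ι : Type*} [Fintype ι]
    {L : Matrix ι ι ℝ} (hL : Lᵀ = -L) (x : ι → ℝ) : x ⬝ᵥ (L *ᵥ x) = 0 := by
  have h : x ⬝ᵥ (L *ᵥ x) = -(x ⬝ᵥ (L *ᵥ x)) := by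
    conv_lhs => rw [Matrix.dotProduct_mulVec, ← Matrix.mulVec_transpose, hL, Matrix.neg_mulVec,
      neg_dotProduct, dotProduct_comm]
  linarith

theorem skew_char_poly_pos_of_posDef (n : ℕ) (A : Matrix (Fin n) (Fin n) ℝ)
    (hA : Aᵀ = A)
    (hpos : ∀ x : Fin n → ℝ, x ≠ 0 → 0 < x ⬝ᵥ (A *ᵥ x)) :
    ∀ Λ : Matrix (Fin n) (Fin n) ℝ, Λᵀ = -Λ → 0 < (A - Λ).det := by
  intro Λ hΛ
  refine Matrix.det_pos_of_dotProduct_mulVec_pos fun x hx => ?_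
  rw [Matrix.sub_mulVec, dotProduct_sub,
    Matrix.dotProduct_mulVec_self_eq_zero_of_transpose_eq_neg hΛ, sub_zero]
  exact hpos x hx
end

section
/- Let A be a symmetric real n×n matrix. The quadratic form x ↦ xᵀAx is definite (either positive definite or negative definite) if and only if its skew-characteristic polynomial is sign-definite, i.e., either det(A − Λ) > 0 for every skew-symmetric real n×n matrix Λ, or det(A − Λ) < 0 for every skew-symmetric real n×n matrix Λ. -/
open Matrix

/-- A real square matrix with positive definite, not necessarily symmetric, bilinear form has
positive determinant. -/
theorem Matrix.det_pos_of_forall_dotProduct_mulVec_pos {ι : Type*} [Fintype ι] [DecidableEq ι]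
    (M : Matrix ι ι ℝ) (hM : ∀ x : ι → ℝ, x ≠ 0 → 0 < x ⬝ᵥ (M *ᵥ x)) : 0 < M.det := by
  by_contra! hdet
  have hcont : Continuous fun t : ℝ => ((1 - t) • (1 : Matrix ι ι ℝ) + t • M).det := by fun_prop
  obtain ⟨t, ⟨ht₀, ht₁⟩, ht⟩ : (0 : ℝ) ∈
      (fun t : ℝ => ((1 - t) • (1 : Matrix ι ι ℝ) + t • M).det) '' Set.Icc 0 1 :=
    intermediate_value_Icc' zero_le_one hcont.continuousOn ⟨by simpa using hdet, by simp⟩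
  obtain ⟨v, hv, hMv⟩ := Matrix.exists_mulVec_eq_zero_iff.mpr ht
  have hform := congrArg (v ⬝ᵥ ·) hMv
  simp only [add_mulVec, smul_mulVec, one_mulVec, dotProduct_add, dotProduct_smul, smul_eq_mul,
    dotProduct_zero] at hform
  have hvv : 0 < v ⬝ᵥ v :=
    lt_of_le_of_ne (Finset.sum_nonneg fun i _ => mul_self_nonneg (v i))
      fun h => hv (dotProduct_self_eq_zero.mp h.symm)
  have hvM := hM v hv
  rcases ht₁.eq_or_lt with rfl | ht₁
  · linarith
  · have h₁ := mul_pos (sub_pos.mpr ht₁) hvv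
    have h₂ := mul_nonneg ht₀ hvM.le
    linarith

/-- An indefinite (or degenerate semidefinite) quadratic form has an isotropic vector. -/
theorem Matrix.exists_isotropic_of_nonpos_of_nonneg {ι : Type*} [Fintype ι]
    (A : Matrix ι ι ℝ) {x y : ι → ℝ} (hx : x ≠ 0) (hy : y ≠ 0)
    (hqx : x ⬝ᵥ (A *ᵥ x) ≤ 0) (hqy : 0 ≤ y ⬝ᵥ (A *ᵥ y)) :
    ∃ v : ι → ℝ, v ≠ 0 ∧ v ⬝ᵥ (A *ᵥ v) = 0 := by
  rcases hqx.eq_or_lt with hqx | hqx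
  · exact ⟨x, hx, hqx⟩
  rcases hqy.eq_or_lt with hqy | hqy
  · exact ⟨y, hy, hqy.symm⟩
  have hcont : Continuous fun t : ℝ =>
      ((1 - t) • x + t • y) ⬝ᵥ (A *ᵥ ((1 - t) • x + t • y)) := by fun_prop
  obtain ⟨t, -, ht⟩ : (0 : ℝ) ∈ (fun t : ℝ =>
      ((1 - t) • x + t • y) ⬝ᵥ (A *ᵥ ((1 - t) • x + t • y))) '' Set.Icc 0 1 :=
    intermediate_value_Icc zero_le_one hcont.continuousOn
      ⟨by simpa using hqx.le, by simpa using hqy.le⟩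
  refine ⟨_, fun hz => ?_, ht⟩
  have hxy : (1 - t) • x = -(t • y) := eq_neg_of_add_eq_zero_left hz
  have hform : ((1 - t) • x) ⬝ᵥ (A *ᵥ ((1 - t) • x)) = (t • y) ⬝ᵥ (A *ᵥ (t • y)) := by
    rw [hxy, mulVec_neg, neg_dotProduct_neg]
  simp only [mulVec_smul, dotProduct_smul, smul_dotProduct, smul_eq_mul] at hform
  have ht₀ : t = 0 := by
    by_contra h
    have h₁ := mul_pos (mul_self_pos.mpr h) hqy
    have h₂ := mul_nonneg (mul_self_nonneg (1 - t)) (neg_nonneg.mpr hqx.le)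
    linarith
  subst ht₀
  simp only [sub_zero, one_mul, zero_mul] at hform
  exact hqx.ne hform

/-- If `v` is isotropic for `A`, then some skew-symmetric matrix agrees with `A` on `v`. -/
theorem Matrix.exists_skew_det_sub_eq_zero {ι : Type*} [Fintype ι] [DecidableEq ι]
    (A : Matrix ι ι ℝ) {v : ι → ℝ} (hv : v ≠ 0) (hqv : v ⬝ᵥ (A *ᵥ v) = 0) :
    ∃ Λ : Matrix ι ι ℝ, Λᵀ = -Λ ∧ (A - Λ).det = 0 := by
  refine ⟨(v ⬝ᵥ v)⁻¹ • (vecMulVec (A *ᵥ v) v - vecMulVec v (A *ᵥ v)), ?_, ?_⟩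
  · rw [transpose_smul, transpose_sub, transpose_vecMulVec, transpose_vecMulVec, ← smul_neg,
      neg_sub]
  · refine Matrix.exists_mulVec_eq_zero_iff.mp ⟨v, hv, ?_⟩
    have hvv : v ⬝ᵥ v ≠ 0 := fun h => hv (dotProduct_self_eq_zero.mp h)
    rw [dotProduct_comm] at hqv
    simp [sub_mulVec, smul_mulVec, vecMulVec_mulVec, hqv, smul_smul, hvv]

theorem Matrix.dotProduct_mulVec_self_eq_zero_of_skew {ι : Type*} [Fintype ι]
    {Λ : Matrix ι ι ℝ} (hΛ : Λᵀ = -Λ) (x : ι → ℝ) : x ⬝ᵥ (Λ *ᵥ x) = 0 := by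
  have h : x ⬝ᵥ (Λ *ᵥ x) = -(x ⬝ᵥ (Λ *ᵥ x)) := by
    conv_lhs => rw [dotProduct_mulVec, ← mulVec_transpose, hΛ, neg_mulVec, neg_dotProduct,
      dotProduct_comm]
  linarith

theorem definite_iff_skew_char_poly_sign_definite (n : ℕ)
    (A : Matrix (Fin n) (Fin n) ℝ) (hA : Aᵀ = A) :
    ((∀ x : Fin n → ℝ, x ≠ 0 → 0 < x ⬝ᵥ (A *ᵥ x)) ∨
     (∀ x : Fin n → ℝ, x ≠ 0 → x ⬝ᵥ (A *ᵥ x) < 0)) ↔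
    ((∀ Λ : Matrix (Fin n) (Fin n) ℝ, Λᵀ = -Λ → 0 < (A - Λ).det) ∨
     (∀ Λ : Matrix (Fin n) (Fin n) ℝ, Λᵀ = -Λ → (A - Λ).det < 0)) := by
  constructor
  · rintro (hpos | hneg)
    · refine Or.inl fun Λ hΛ => det_pos_of_forall_dotProduct_mulVec_pos _ fun x hx => ?_
      rw [sub_mulVec, dotProduct_sub, dotProduct_mulVec_self_eq_zero_of_skew hΛ, sub_zero]
      exact hpos x hx
    · have hdet : ∀ Λ : Matrix (Fin n) (Fin n) ℝ, Λᵀ = -Λ → 0 < (-1) ^ n * (A - Λ).det := by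
        intro Λ hΛ
        have h : 0 < (-(A - Λ)).det := det_pos_of_forall_dotProduct_mulVec_pos _ fun x hx => by
          rw [neg_mulVec, dotProduct_neg, sub_mulVec, dotProduct_sub,
            dotProduct_mulVec_self_eq_zero_of_skew hΛ, sub_zero]
          exact neg_pos.mpr (hneg x hx)
        rwa [det_neg, Fintype.card_fin] at h
      rcases n.even_or_odd with hn | hn
      · exact Or.inl fun Λ hΛ => by simpa [hn.neg_one_pow] using hdet Λ hΛ
      · exact Or.inr fun Λ hΛ => by simpa [hn.neg_one_pow] using hdet Λ hΛ
  · intro hdet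
    by_contra! hindef
    obtain ⟨⟨x, hx, hqx⟩, y, hy, hqy⟩ := hindef
    obtain ⟨v, hv, hqv⟩ := A.exists_isotropic_of_nonpos_of_nonneg hx hy hqx hqy
    obtain ⟨Λ, hΛ, hzero⟩ := A.exists_skew_det_sub_eq_zero hv hqv
    rcases hdet with h | h
    · exact (h Λ hΛ).ne' hzero
    · exact (h Λ hΛ).ne hzero
end

section
/- Let A be a symmetric negative definite real n×n matrix. Then for every skew-symmetric real n×n matrix Λ, one has (−1)ⁿ · det(A − Λ) > 0; in particular det(A − Λ) > 0 for all skew-symmetric Λ when n is even, and det(A − Λ) < 0 for all skew-symmetric Λ when n is odd. -/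
open Matrix

namespace Matrix

variable {ι : Type*} [Fintype ι]

theorem dotProduct_mulVec_eq_zero_of_transpose_eq_neg {S : Matrix ι ι ℝ} (hS : Sᵀ = -S)
    (x : ι → ℝ) : x ⬝ᵥ (S *ᵥ x) = 0 := by
  have h : x ⬝ᵥ (S *ᵥ x) = -(x ⬝ᵥ (S *ᵥ x)) := by
    conv_lhs => rw [dotProduct_mulVec, ← mulVec_transpose, hS, neg_mulVec, neg_dotProduct,
      dotProduct_comm]
  linarith

theorem det_ne_zero_of_dotProduct_mulVec_pos_s2 [DecidableEq ι] {M : Matrix ι ι ℝ}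
    (hM : ∀ x : ι → ℝ, x ≠ 0 → 0 < x ⬝ᵥ (M *ᵥ x)) : M.det ≠ 0 := by
  intro h
  obtain ⟨v, hv, hMv⟩ := exists_mulVec_eq_zero_iff.mpr h
  have := hM v hv
  simp [hMv] at this

/-- A real matrix, not necessarily symmetric, whose quadratic form is positive has positive
determinant: the segment joining it to the identity consists of invertible matrices. -/
theorem det_pos_of_dotProduct_mulVec_pos_s2 [DecidableEq ι] {M : Matrix ι ι ℝ}
    (hM : ∀ x : ι → ℝ, x ≠ 0 → 0 < x ⬝ᵥ (M *ᵥ x)) : 0 < M.det := by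
  let f : ℝ → ℝ := fun t => ((1 - t) • (1 : Matrix ι ι ℝ) + t • M).det
  have hf : Continuous f := by fun_prop
  have hf0 : f 0 = 1 := by simp [f]
  have hf1 : f 1 = M.det := by simp [f]
  by_contra! hdet
  obtain ⟨t, ⟨ht0, ht1⟩, hft⟩ : (0 : ℝ) ∈ f '' Set.Icc 0 1 :=
    intermediate_value_Icc' zero_le_one hf.continuousOn
      ⟨hf1.trans_le hdet, hf0 ▸ zero_le_one⟩
  refine det_ne_zero_of_dotProduct_mulVec_pos_s2 (fun x hx => ?_) hft
  have hxx : 0 < x ⬝ᵥ x := by simpa using dotProduct_star_self_pos_iff.mpr hx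
  have hMx := hM x hx
  simp only [add_mulVec, smul_mulVec, one_mulVec, dotProduct_add, dotProduct_smul, smul_eq_mul]
  rcases ht0.eq_or_lt with rfl | ht
  · simpa using hxx
  · have := mul_nonneg (sub_nonneg.mpr ht1) hxx.le
    have := mul_pos ht hMx
    linarith

end Matrix

theorem skew_char_poly_of_negDef (n : ℕ) (A : Matrix (Fin n) (Fin n) ℝ)
    (hA : Aᵀ = A)
    (hneg : ∀ x : Fin n → ℝ, x ≠ 0 → x ⬝ᵥ (A *ᵥ x) < 0) :
    ∀ Λ : Matrix (Fin n) (Fin n) ℝ, Λᵀ = -Λ →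
      0 < (-1 : ℝ) ^ n * (A - Λ).det ∧
      (Even n → 0 < (A - Λ).det) ∧
      (Odd n → (A - Λ).det < 0) := by
  intro Λ hΛ
  have hpos : 0 < (-1 : ℝ) ^ n * (A - Λ).det := by
    have h : 0 < (-(A - Λ)).det := det_pos_of_dotProduct_mulVec_pos_s2 fun x hx => by
      rw [neg_mulVec, sub_mulVec, dotProduct_neg, dotProduct_sub,
        dotProduct_mulVec_eq_zero_of_transpose_eq_neg hΛ]
      linarith [hneg x hx]
    rwa [det_neg, Fintype.card_fin] at h
  refine ⟨hpos, fun hn => ?_, fun hn => ?_⟩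
  · simpa [hn.neg_one_pow] using hpos
  · simpa [hn.neg_one_pow] using hpos
end

section
/- Let n ≥ 2 and 1 ≤ m ≤ n − 1. Let A be the diagonal n×n real matrix whose first m diagonal entries are 1 and whose remaining n − m diagonal entries are −1. For a real parameter t, let Λ be the skew-symmetric n×n matrix whose only nonzero entries are Λ_{m,m+1} = t and Λ_{m+1,m} = −t. Then det(A − Λ) = (−1)^{n−m−1} · (t² − 1). In particular det(A − Λ) takes both strictly positive and strictly negative values as t varies, so the skew-characteristic polynomial of A is not sign-definite. -/
open Matrix

/-- The diagonal with `k + 1` ones, then one entry `c`, then `r` entries `-1` has product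
`(-1) ^ r * c`. -/
lemma prod_fin_ones_pivot_neg_ones (k r : ℕ) (c : ℝ) :
    ∏ i : Fin (k + 2 + r), (if (i : ℕ) < k + 1 then (1 : ℝ) else if (i : ℕ) = k + 1 then c else -1)
      = (-1) ^ r * c := by
  rw [Fin.prod_univ_eq_prod_range
    (fun i : ℕ => if i < k + 1 then (1 : ℝ) else if i = k + 1 then c else -1),
    Finset.prod_range_add, Finset.prod_range_succ, Finset.prod_eq_one, Finset.prod_congr rfl
      (g := fun _ => (-1 : ℝ))]
  · simp [mul_comm]
  · intro x _
    rw [if_neg (by omega), if_neg (by omega)]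
  · intro x hx
    rw [if_pos (Finset.mem_range.mp hx)]

theorem skew_char_poly_indefinite_signature (n m : ℕ)
    (hn : 2 ≤ n) (hm1 : 1 ≤ m) (hm2 : m ≤ n - 1)
    (A : Matrix (Fin n) (Fin n) ℝ)
    (hA : A = Matrix.diagonal fun i : Fin n => if (i : ℕ) < m then (1 : ℝ) else -1)
    (Λ : ℝ → Matrix (Fin n) (Fin n) ℝ)
    (hΛ : ∀ t : ℝ, ∀ i j : Fin n,
      Λ t i j = if (i : ℕ) = m - 1 ∧ (j : ℕ) = m then t
        else if (i : ℕ) = m ∧ (j : ℕ) = m - 1 then -t else 0) :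
    (∀ t : ℝ, (A - Λ t).det = (-1 : ℝ) ^ (n - m - 1) * (t ^ 2 - 1)) ∧
    (∃ t : ℝ, 0 < (A - Λ t).det) ∧ (∃ t : ℝ, (A - Λ t).det < 0) := by
  have hdet : ∀ t : ℝ, (A - Λ t).det = (-1 : ℝ) ^ (n - m - 1) * (t ^ 2 - 1) := by
    intro t
    obtain ⟨k, rfl⟩ : ∃ k, m = k + 1 := ⟨m - 1, by omega⟩
    obtain ⟨r, rfl⟩ : ∃ r, n = k + 2 + r := ⟨n - (k + 2), by omega⟩
    have hexp : k + 2 + r - (k + 1) - 1 = r := by omega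
    rw [hexp, ← prod_fin_ones_pivot_neg_ones k r (t ^ 2 - 1)]
    let p : Fin (k + 2 + r) := ⟨k, by omega⟩
    let q : Fin (k + 2 + r) := ⟨k + 1, by omega⟩
    have hpq : q ≠ p := by simp [p, q]
    have hM : ∀ i j : Fin (k + 2 + r),
        (A - Λ t).updateRow q ((A - Λ t) q + (-t) • (A - Λ t) p) i j =
          if i = j then
            if (i : ℕ) < k + 1 then 1 else if (i : ℕ) = k + 1 then t ^ 2 - 1 else -1
          else if i = p ∧ j = q then -t else 0 := by
      intro i j
      simp only [updateRow_apply, Matrix.sub_apply, Pi.add_apply, Pi.smul_apply, smul_eq_mul, hA, hΛ,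
        diagonal_apply, Fin.ext_iff, p, q, Nat.add_sub_cancel]
      grind
    rw [← det_updateRow_add_smul_self _ hpq (-t), det_of_isUpperTriangular]
    · exact Finset.prod_congr rfl fun i _ => by rw [hM, if_pos rfl]
    · intro i j hij
      have hji : (j : ℕ) < i := hij
      rw [hM, if_neg (by simp only [Fin.ext_iff]; omega),
        if_neg (by simp only [Fin.ext_iff, p, q]; omega)]
  refine ⟨hdet, ?_⟩
  simp only [hdet]
  rcases neg_one_pow_eq_or ℝ (n - m - 1) with h | h <;> rw [h]
  · exact ⟨⟨2, by norm_num⟩, ⟨0, by norm_num⟩⟩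
  · exact ⟨⟨0, by norm_num⟩, ⟨2, by norm_num⟩⟩
end
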